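/- Let A be an enriched matrix. If A contains none of D_0, D_1, D_4, D_6, nor their dual matrices as subconfigurations, then: (i) for every two rows of A colored with the same color and labeled one with L and the other with R, and every nonempty LR-row r of A, one of the two rows is contained in r; and (ii) for every two rows of A colored with distinct colors and both labeled L (or both labeled R), and every nonempty LR-row r of A, one of the two rows is contained in r. -/

import Mathlib

/-- Labels for rows of an enriched matrix. -/
inductive RowLabel : Type
  | L | R | LR
deriving DecidableEq

/-- Colors for rows/blocks of an enriched matrix. -/
inductive RowColor : Type
  | red | blue
deriving DecidableEq

/-- An enriched matrix: a (0,1)-matrix whose rows may carry an optional label in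
{L, R, LR} and an optional color in {red, blue}, where only L-rows, R-rows and
all-zero LR-rows may be colored, and all colored all-zero LR-rows have the same
color. -/
structure EnrichedMatrix (m n : ℕ) : Type where
  entry : Fin m → Fin n → Bool
  label : Fin m → Option RowLabel
  color : Fin m → Option RowColor
  color_rows : ∀ i, (color i).isSome = true →
    label i = some RowLabel.L ∨ label i = some RowLabel.R ∨
      (label i = some RowLabel.LR ∧ ∀ j, entry i j = false)
  lr_color_unique : ∀ i k, label i = some RowLabel.LR → label k = some RowLabel.LR →
    (color i).isSome = true → (color k).isSome = true → color i = color k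

namespace EnrichedMatrix

variable {m n : ℕ} (A : EnrichedMatrix m n)

/-- Two rows are disjoint: they share no 1-column. -/
def RowDisj (i k : Fin m) : Prop := ∀ j, ¬(A.entry i j = true ∧ A.entry k j = true)

/-- Row `i` is contained in row `k`. -/
def RowLe (i k : Fin m) : Prop := ∀ j, A.entry i j = true → A.entry k j = true

/-- Two rows are nested: one is contained in the other. -/
def RowNested (i k : Fin m) : Prop := A.RowLe i k ∨ A.RowLe k i

/-- A row is nonempty: it has at least one 1. -/
def RowNonempty (i : Fin m) : Prop := ∃ j, A.entry i j = true

/-- Rows `i` and `k` are both colored, with the same color. -/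
def SameColor (i k : Fin m) : Prop := ∃ c, A.color i = some c ∧ A.color k = some c

/-- Rows `i` and `k` are both colored, with distinct colors. -/
def DistinctColors (i k : Fin m) : Prop :=
  ∃ c d, A.color i = some c ∧ A.color k = some d ∧ c ≠ d

end EnrichedMatrix

namespace EnrichedMatrix

/-- `A` contains `D_0` (for `ℓ = L`) or its dual (for `ℓ = R`) as a subconfiguration. -/
def ContainsD0 {m n : ℕ} (A : EnrichedMatrix m n) (ℓ : RowLabel) : Prop :=
  ∃ (i₁ i₂ : Fin m) (j₁ j₂ : Fin n), i₁ ≠ i₂ ∧ j₁ ≠ j₂ ∧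
    A.label i₁ = some ℓ ∧ A.label i₂ = some ℓ ∧
    A.entry i₁ j₁ = true ∧ A.entry i₁ j₂ = false ∧
    A.entry i₂ j₁ = false ∧ A.entry i₂ j₂ = true

/-- `A` contains `D_1` (or, equivalently up to permutations, its dual) as a
subconfiguration. -/
def ContainsD1 {m n : ℕ} (A : EnrichedMatrix m n) : Prop :=
  ∃ (i₁ i₂ : Fin m) (j : Fin n),
    A.label i₁ = some RowLabel.L ∧ A.label i₂ = some RowLabel.R ∧
    A.SameColor i₁ i₂ ∧ A.entry i₁ j = true ∧ A.entry i₂ j = true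

/-- `A` contains `D_4` (for `ℓ = L`) or its dual (for `ℓ = R`) as a subconfiguration. -/
def ContainsD4 {m n : ℕ} (A : EnrichedMatrix m n) (ℓ : RowLabel) : Prop :=
  ∃ (i₁ i₂ i₃ : Fin m) (j : Fin n),
    A.label i₁ = some ℓ ∧ A.label i₂ = some ℓ ∧ A.DistinctColors i₁ i₂ ∧
    A.label i₃ = some RowLabel.LR ∧ A.color i₃ = none ∧
    A.entry i₁ j = true ∧ A.entry i₂ j = true ∧ A.entry i₃ j = false

/-- `A` contains `D_6` (or, equivalently up to permutations, its dual) as a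
subconfiguration: rows (10) labeled L and (01) labeled R colored with the same color,
and an uncolored LR-row with 0s in both columns. -/
def ContainsD6 {m n : ℕ} (A : EnrichedMatrix m n) : Prop :=
  ∃ (i₁ i₂ i₃ : Fin m) (j₁ j₂ : Fin n), j₁ ≠ j₂ ∧
    A.label i₁ = some RowLabel.L ∧ A.label i₂ = some RowLabel.R ∧
    A.SameColor i₁ i₂ ∧ A.label i₃ = some RowLabel.LR ∧ A.color i₃ = none ∧
    A.entry i₁ j₁ = true ∧ A.entry i₁ j₂ = false ∧
    A.entry i₂ j₁ = false ∧ A.entry i₂ j₂ = true ∧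
    A.entry i₃ j₁ = false ∧ A.entry i₃ j₂ = false

end EnrichedMatrix

namespace EnrichedMatrix

variable {m n : ℕ} (A : EnrichedMatrix m n)

theorem color_eq_none_of_rowNonempty {r : Fin m} (hr : A.label r = some RowLabel.LR)
    (hne : A.RowNonempty r) : A.color r = none := by
  obtain ⟨j, hj⟩ := hne
  by_contra hc
  rcases A.color_rows r (Option.isSome_iff_ne_none.mpr hc) with h | h | ⟨-, h⟩ <;> simp_all

theorem exists_entry_of_not_rowLe {i r : Fin m} (h : ¬ A.RowLe i r) :
    ∃ j, A.entry i j = true ∧ A.entry r j = false := by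
  simpa [RowLe] using h

theorem rowLe_or_rowLe_of_sameColor (h₁ : ¬ A.ContainsD1) (h₆ : ¬ A.ContainsD6)
    {i k r : Fin m} (hi : A.label i = some RowLabel.L) (hk : A.label k = some RowLabel.R)
    (hc : A.SameColor i k) (hr : A.label r = some RowLabel.LR) (hne : A.RowNonempty r) :
    A.RowLe i r ∨ A.RowLe k r := by
  by_contra! h
  obtain ⟨a, hia, hra⟩ := A.exists_entry_of_not_rowLe h.1
  obtain ⟨b, hkb, hrb⟩ := A.exists_entry_of_not_rowLe h.2
  have hdisj : ∀ j, A.entry i j = true → A.entry k j = true → False :=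
    fun j hij hkj => h₁ ⟨i, k, j, hi, hk, hc, hij, hkj⟩
  have hka : A.entry k a = false := Bool.eq_false_iff.mpr (hdisj a hia)
  have hib : A.entry i b = false := Bool.eq_false_iff.mpr fun hib => hdisj b hib hkb
  have hab : a ≠ b := by
    rintro rfl
    exact hdisj a hia hkb
  exact h₆ ⟨i, k, r, a, b, hab, hi, hk, hc, hr, A.color_eq_none_of_rowNonempty hr hne,
    hia, hib, hka, hkb, hra, hrb⟩

theorem rowLe_or_rowLe_of_distinctColors {l : RowLabel} (h₀ : ¬ A.ContainsD0 l)
    (h₄ : ¬ A.ContainsD4 l) {i k r : Fin m} (hi : A.label i = some l)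
    (hk : A.label k = some l) (hc : A.DistinctColors i k)
    (hr : A.label r = some RowLabel.LR) (hne : A.RowNonempty r) :
    A.RowLe i r ∨ A.RowLe k r := by
  by_contra! h
  obtain ⟨a, hia, hra⟩ := A.exists_entry_of_not_rowLe h.1
  obtain ⟨b, hkb, hrb⟩ := A.exists_entry_of_not_rowLe h.2
  have hcommon : ∀ j, A.entry r j = false → A.entry i j = true → A.entry k j = true → False :=
    fun j hrj hij hkj => h₄ ⟨i, k, r, j, hi, hk, hc, hr,
      A.color_eq_none_of_rowNonempty hr hne, hij, hkj, hrj⟩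
  have hka : A.entry k a = false := Bool.eq_false_iff.mpr (hcommon a hra hia)
  have hib : A.entry i b = false := Bool.eq_false_iff.mpr fun hib => hcommon b hrb hib hkb
  have hab : a ≠ b := by
    rintro rfl
    exact hcommon a hra hia hkb
  have hik : i ≠ k := by
    rintro rfl
    simp [hia] at hka
  exact h₀ ⟨i, k, a, b, hik, hab, hi, hk, hia, hib, hka, hkb⟩

end EnrichedMatrix

/-- If `A` contains none of `D_0`, `D_1`, `D_4`, `D_6`, nor their duals, then: (i) for
every two rows colored with the same color and labeled one with L and the other with R,
and every nonempty LR-row `r`, one of the two rows is contained in `r`; and (ii) for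
every two rows colored with distinct colors and both labeled L (or both labeled R), and
every nonempty LR-row `r`, one of the two rows is contained in `r`. -/
theorem no_D0_D1_D4_D6_implies {m n : ℕ} (A : EnrichedMatrix m n)
    (h₀L : ¬ A.ContainsD0 RowLabel.L) (h₀R : ¬ A.ContainsD0 RowLabel.R)
    (h₁ : ¬ A.ContainsD1)
    (h₄L : ¬ A.ContainsD4 RowLabel.L) (h₄R : ¬ A.ContainsD4 RowLabel.R)
    (h₆ : ¬ A.ContainsD6) :
    (∀ i k r : Fin m, A.label i = some RowLabel.L → A.label k = some RowLabel.R →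
        A.SameColor i k → A.label r = some RowLabel.LR → A.RowNonempty r →
        A.RowLe i r ∨ A.RowLe k r) ∧
    (∀ i k r : Fin m,
        ((A.label i = some RowLabel.L ∧ A.label k = some RowLabel.L) ∨
         (A.label i = some RowLabel.R ∧ A.label k = some RowLabel.R)) →
        A.DistinctColors i k → A.label r = some RowLabel.LR → A.RowNonempty r →
        A.RowLe i r ∨ A.RowLe k r) := by
  refine ⟨fun i k r hi hk => A.rowLe_or_rowLe_of_sameColor h₁ h₆ hi hk, ?_⟩
  rintro i k r (⟨hi, hk⟩ | ⟨hi, hk⟩)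
  · exact A.rowLe_or_rowLe_of_distinctColors h₀L h₄L hi hk
  · exact A.rowLe_or_rowLe_of_distinctColors h₀R h₄R hi hk
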